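/- (Extremality of the natural generators of a free group.) Let F_k be the free group on k generators, k ≥ 2, with natural symmetric generating set S = {x₁, …, x_k, x₁⁻¹, …, x_k⁻¹}, and let μ be the uniform probability measure on S. Then the fundamental inequality turns into equality: h(F_k, μ) = l(μ) · v, where v = log(2k−1) is the logarithmic volume in S, l(μ) = (k−1)/k is the drift, and h(F_k, μ) = ((k−1)/k) log(2k−1) is the entropy. -/

import Mathlib

open Filter

/-- Shannon entropy `H(ν) = −Σ_g ν(g) log ν(g)` (natural logarithm, `0 log 0 = 0`). -/
noncomputable def shannonEntropy {G : Type*} (ν : G → ℝ) : ℝ :=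
  -∑ᶠ g, ν g * Real.log (ν g)

/-- Convolution of two densities on a group: `(ν₁ * ν₂)(g) = Σ_{ab = g} ν₁(a) ν₂(b)`. -/
noncomputable def convMeas {G : Type*} [Group G] (ν₁ ν₂ : G → ℝ) : G → ℝ :=
  fun g => ∑ᶠ a, ν₁ a * ν₂ (a⁻¹ * g)

/-- The `n`-fold convolution `μ^{*n}` of a density `μ` with itself. -/
noncomputable def convPow {G : Type*} [Group G] (μ : G → ℝ) : ℕ → G → ℝ
  | 0 => Set.indicator {(1 : G)} (fun _ => (1 : ℝ))
  | n + 1 => convMeas (convPow μ n) μ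

/-- The uniform probability measure on the `2k` natural generators
`{x₁, …, x_k, x₁⁻¹, …, x_k⁻¹}` of the free group `F_k`. -/
noncomputable def freeUniform (k : ℕ) : FreeGroup (Fin k) → ℝ :=
  Set.indicator {g | ∃ i : Fin k, g = FreeGroup.of i ∨ g = (FreeGroup.of i)⁻¹}
    (fun _ => 1 / (2 * (k : ℝ)))

namespace FGE
open FreeGroup

abbrev letr {k : ℕ} (x : Fin k × Bool) : FreeGroup (Fin k) := FreeGroup.mk [x]

def bar {k : ℕ} : (Fin k × Bool) ≃ (Fin k × Bool) where
  toFun x := (x.1, !x.2)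
  invFun x := (x.1, !x.2)
  left_inv x := by simp
  right_inv x := by simp

lemma letr_inv {k : ℕ} (x : Fin k × Bool) : (letr x)⁻¹ = letr (bar x) := by
  simp [letr, bar, FreeGroup.inv_mk, FreeGroup.invRev]

lemma bar_bar {k : ℕ} (x : Fin k × Bool) : bar (bar x) = x := by simp [bar]

lemma letr_inj {k : ℕ} : Function.Injective (letr (k := k)) := by
  intro x y h
  have h2 := congrArg FreeGroup.toWord h
  simpa [letr, FreeGroup.toWord_mk, FreeGroup.reduce_singleton] using h2

lemma norm_letr_mul {k : ℕ} (x : Fin k × Bool) (g : FreeGroup (Fin k)) :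
    FreeGroup.norm (letr x * g) = if g.toWord.head? = some (bar x) then
      FreeGroup.norm g - 1 else FreeGroup.norm g + 1 := by
  have h1 : (letr x * g).toWord = FreeGroup.reduce (x :: g.toWord) := by
    conv_lhs => rw [← FreeGroup.mk_toWord (x := g)]
    simp [letr]
  unfold FreeGroup.norm
  rw [h1, FreeGroup.reduce.cons, FreeGroup.reduce_toWord]
  rcases hw : g.toWord with _ | ⟨y, L⟩
  · simp
  · obtain ⟨x1, x2⟩ := x
    obtain ⟨y1, y2⟩ := y
    simp only [List.head?_cons, Option.some.injEq, bar, Equiv.coe_fn_mk, Prod.mk.injEq]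
    by_cases h : x1 = y1 ∧ x2 = !y2
    · have h' : y1 = x1 ∧ y2 = !x2 := by obtain ⟨a, b⟩ := h; simp [a, b]
      rw [if_pos h', if_pos h]; simp
    · have h' : ¬ (y1 = x1 ∧ y2 = !x2) := by
        rintro ⟨a, b⟩; exact h (by simp [a, b])
      rw [if_neg h', if_neg h]; simp

lemma sum_left {k : ℕ} (F : ℕ → ℝ) (g : FreeGroup (Fin k)) :
    ∑ x : Fin k × Bool, F (FreeGroup.norm (letr x * g)) =
      if FreeGroup.norm g = 0 then 2 * (k : ℝ) * F 1 else
        F (FreeGroup.norm g - 1) + (2 * (k : ℝ) - 1) * F (FreeGroup.norm g + 1) := by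
  simp_rw [norm_letr_mul]
  unfold FreeGroup.norm
  rcases hw : g.toWord with _ | ⟨y, L⟩
  · simp [mul_comm]
  · have : ∀ x : Fin k × Bool, F (if (some y = some (bar x)) then L.length else L.length + 2)
        = F (L.length + 2) + if x = bar y then F L.length - F (L.length + 2) else 0 := by
      intro x
      by_cases h : x = bar y
      · subst h; simp [bar_bar]
      · have : y ≠ bar x := by rintro rfl; exact h (bar_bar x).symm
        simp [h, this]
    simp only [List.head?_cons, List.length_cons, Nat.add_sub_cancel, Nat.add_assoc, Nat.reduceAdd]
    simp only [this, Finset.sum_add_distrib]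
    simp
    ring

lemma sum_right {k : ℕ} (F : ℕ → ℝ) (g : FreeGroup (Fin k)) :
    ∑ x : Fin k × Bool, F (FreeGroup.norm (g * letr x)) =
      if FreeGroup.norm g = 0 then 2 * (k : ℝ) * F 1 else
        F (FreeGroup.norm g - 1) + (2 * (k : ℝ) - 1) * F (FreeGroup.norm g + 1) := by
  have h := sum_left F g⁻¹
  rw [FreeGroup.norm_inv_eq] at h
  rw [← h, ← Equiv.sum_comp bar]
  refine Finset.sum_congr rfl fun x _ => ?_
  rw [← FreeGroup.norm_inv_eq, mul_inv_rev, letr_inv, bar_bar]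

lemma freeUniform_eq {k : ℕ} (g : FreeGroup (Fin k)) :
    (∃ x, g = letr x) ∧ freeUniform k g = 1 / (2 * (k : ℝ)) ∨
    (¬ ∃ x, g = letr x) ∧ freeUniform k g = 0 := by
  have key : (∃ x, g = letr x) ↔ ∃ i : Fin k, g = FreeGroup.of i ∨ g = (FreeGroup.of i)⁻¹ := by
    constructor
    · rintro ⟨⟨i, b⟩, rfl⟩
      refine ⟨i, ?_⟩
      cases b
      · right; simp [letr, FreeGroup.of, FreeGroup.inv_mk, FreeGroup.invRev]
      · left; rfl
    · rintro ⟨i, h | h⟩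
      · exact ⟨(i, true), h⟩
      · exact ⟨(i, false), by rw [h]; simp [letr, FreeGroup.of, FreeGroup.inv_mk, FreeGroup.invRev]⟩
  by_cases h : ∃ x, g = letr x
  · left
    refine ⟨h, ?_⟩
    unfold freeUniform
    rw [Set.indicator_apply]; exact if_pos (key.1 h)
  · right
    refine ⟨h, ?_⟩
    unfold freeUniform
    rw [Set.indicator_apply]; exact if_neg (fun hh => h (key.2 hh))

lemma conv_step {k : ℕ} (ν : FreeGroup (Fin k) → ℝ) (g : FreeGroup (Fin k)) :
    convMeas ν (freeUniform k) g = (∑ x : Fin k × Bool, ν (g * letr x)) / (2 * (k : ℝ)) := by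
  classical
  unfold convMeas
  have hinj : Function.Injective (fun x : Fin k × Bool => g * letr x) := fun x y h =>
    letr_inj (mul_left_cancel h)
  rw [finsum_eq_sum_of_support_subset (s := Finset.univ.image (fun x => g * letr x)),
    Finset.sum_image (fun x _ y _ h => hinj h), Finset.sum_div]
  · refine Finset.sum_congr rfl fun x _ => ?_
    have e : (g * letr x)⁻¹ * g = letr (bar x) := by
      rw [mul_inv_rev, letr_inv]; group
    rw [e]
    rcases freeUniform_eq (letr (bar x)) with h | h
    · rw [h.2]; ring
    · exact absurd ⟨_, rfl⟩ h.1
  · intro a ha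
    rcases freeUniform_eq (a⁻¹ * g) with h | h
    · obtain ⟨y, hy⟩ := h.1
      simp only [Finset.coe_image, Finset.coe_univ, Set.image_univ, Set.mem_range]
      refine ⟨bar y, ?_⟩
      rw [← letr_inv, ← hy]; group
    · simp [h.2] at ha

/-- radial profile of the `n`-step law -/
noncomputable def prof (k : ℕ) : ℕ → ℕ → ℝ
  | 0, m => if m = 0 then 1 else 0
  | n + 1, m => if m = 0 then prof k n 1 else
      (prof k n (m - 1) + (2 * (k : ℝ) - 1) * prof k n (m + 1)) / (2 * (k : ℝ))

lemma convPow_eq {k : ℕ} (hk : 2 ≤ k) (n : ℕ) (g : FreeGroup (Fin k)) :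
    convPow (freeUniform k) n g = prof k n (FreeGroup.norm g) := by
  have hk0 : (k : ℝ) ≠ 0 := by positivity
  induction n generalizing g with
  | zero =>
    simp only [convPow, prof, FreeGroup.norm_eq_zero, Set.indicator_apply, Set.mem_singleton_iff]
  | succ n ih =>
    simp only [convPow, conv_step, ih, sum_right, prof]
    split_ifs
    · field_simp
    · rfl

lemma prof_nonneg {k : ℕ} (hk : 2 ≤ k) (n m : ℕ) : 0 ≤ prof k n m := by
  have h2 : (2 : ℝ) ≤ k := by exact_mod_cast hk
  induction n generalizing m with
  | zero => simp only [prof]; split_ifs <;> norm_num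
  | succ n ih =>
    simp only [prof]
    split_ifs
    · exact ih 1
    · have := ih (m - 1)
      have := ih (m + 1)
      have : 0 ≤ 2 * (k : ℝ) - 1 := by linarith
      positivity

lemma prof_zero {k : ℕ} (n m : ℕ) (h : n < m) : prof k n m = 0 := by
  induction n generalizing m with
  | zero => simp only [prof]; rw [if_neg (by omega)]
  | succ n ih =>
    simp only [prof]
    rw [if_neg (by omega), ih _ (by omega), ih _ (by omega)]
    simp

lemma prof_le {k : ℕ} (hk : 2 ≤ k) (n m : ℕ) :
    prof k n m ≤ (7 / 8) ^ n * (1 / 2) ^ m := by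
  have h2 : (2 : ℝ) ≤ k := by exact_mod_cast hk
  induction n generalizing m with
  | zero =>
    simp only [prof]; split_ifs with h
    · simp [h]
    · positivity
  | succ n ih =>
    simp only [prof]
    split_ifs with h
    · subst h
      have := ih 1
      have hp : (0 : ℝ) < (7 / 8) ^ n := by positivity
      rw [pow_succ]
      linarith
    · obtain ⟨j, rfl⟩ : ∃ j, m = j + 1 := ⟨m - 1, by omega⟩
      have h1 := ih j
      have h3 := ih (j + 1 + 1)
      simp only [Nat.add_sub_cancel]
      rw [div_le_iff₀ (by positivity)]
      have hp : (0 : ℝ) < (7 / 8) ^ n * (1 / 2) ^ j := by positivity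
      set P := (7 / 8 : ℝ) ^ n * (1 / 2) ^ j
      have e1 : (7 / 8 : ℝ) ^ n * (1 / 2) ^ (j + 1 + 1) = P / 4 := by simp only [P]; ring
      have e2 : (7 / 8 : ℝ) ^ (n + 1) * (1 / 2) ^ (j + 1) = P * (7 / 16) := by simp only [P]; ring
      rw [e1] at h3
      rw [e2]
      have := mul_le_mul_of_nonneg_left h3 (by linarith : 0 ≤ 2 * (k : ℝ) - 1)
      nlinarith

lemma sphere_finite (k m : ℕ) : {g : FreeGroup (Fin k) | FreeGroup.norm g = m}.Finite :=
  Set.Finite.of_finite_image (f := FreeGroup.toWord)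
    ((List.finite_length_eq (Fin k × Bool) m).subset (by rintro _ ⟨g, hg, rfl⟩; exact hg))
    (FreeGroup.toWord_injective.injOn)

noncomputable def sph (k m : ℕ) : Finset (FreeGroup (Fin k)) := (sphere_finite k m).toFinset

lemma mem_sph {k m : ℕ} {g : FreeGroup (Fin k)} : g ∈ sph k m ↔ FreeGroup.norm g = m := by
  simp [sph]

noncomputable def vol (k m : ℕ) : ℝ :=
  (({g : FreeGroup (Fin k) | FreeGroup.norm g = m}).ncard : ℝ)

lemma vol_eq (k m : ℕ) : vol k m = ((sph k m).card : ℝ) := by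
  rw [vol, sph, Set.ncard_eq_toFinset_card _ (sphere_finite k m)]

lemma vol_zero (k : ℕ) : vol k 0 = 1 := by
  have : {g : FreeGroup (Fin k) | FreeGroup.norm g = 0} = {1} := by
    ext g; simp [FreeGroup.norm_eq_zero]
  simp [vol, this]

lemma vol_succ (k m : ℕ) :
    vol k (m + 1) = vol k m * (if m = 0 then 2 * (k : ℝ) else 2 * (k : ℝ) - 1) := by
  classical
  have A : ∑ g ∈ sph k m, ∑ x : Fin k × Bool,
      (if FreeGroup.norm (g * letr x) = m + 1 then (1 : ℝ) else 0) =
      vol k m * (if m = 0 then 2 * (k : ℝ) else 2 * (k : ℝ) - 1) := by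
    rw [vol_eq, ← nsmul_eq_mul, ← Finset.sum_const]
    refine Finset.sum_congr rfl fun g hg => ?_
    rw [sum_right (fun j => if j = m + 1 then (1 : ℝ) else 0), mem_sph.1 hg]
    split_ifs <;> first | omega | simp_all
  have B : ∑ g ∈ sph k (m + 1), ∑ x : Fin k × Bool,
      (if FreeGroup.norm (g * letr x) = m then (1 : ℝ) else 0) = vol k (m + 1) := by
    rw [vol_eq, ← nsmul_one, ← Finset.sum_const]
    refine Finset.sum_congr rfl fun g hg => ?_
    rw [sum_right (fun j => if j = m then (1 : ℝ) else 0), mem_sph.1 hg]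
    simp only [Nat.add_eq_zero_iff, one_ne_zero, and_false, if_false, Nat.add_sub_cancel, if_true]
    rw [if_neg (by omega)]; ring
  rw [← A, ← B, ← Finset.sum_product', ← Finset.sum_product', ← Finset.sum_filter,
    ← Finset.sum_filter]
  refine Finset.sum_nbij' (fun p => (p.1 * letr p.2, bar p.2)) (fun p => (p.1 * letr p.2, bar p.2))
    ?_ ?_ ?_ ?_ ?_
  · rintro ⟨g, x⟩ h
    simp only [Finset.mem_filter, Finset.mem_product, mem_sph, Finset.mem_univ, and_true] at h ⊢
    refine ⟨h.2, ?_⟩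
    rw [← letr_inv, mul_inv_cancel_right]; exact h.1
  · rintro ⟨g, x⟩ h
    simp only [Finset.mem_filter, Finset.mem_product, mem_sph, Finset.mem_univ, and_true] at h ⊢
    refine ⟨h.2, ?_⟩
    rw [← letr_inv, mul_inv_cancel_right]; exact h.1
  · rintro ⟨g, x⟩ h
    simp only [← letr_inv, mul_inv_cancel_right, bar_bar]
  · rintro ⟨g, x⟩ h
    simp only [← letr_inv, mul_inv_cancel_right, bar_bar]
  · intros; rfl

lemma vol_formula (k m : ℕ) : vol k (m + 1) = 2 * (k : ℝ) * (2 * (k : ℝ) - 1) ^ m := by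
  induction m with
  | zero => rw [vol_succ, vol_zero]; simp
  | succ m ih => rw [vol_succ, ih]; simp; ring

lemma finsum_radial (k n : ℕ) (F : ℕ → ℝ) (hF : ∀ m, n < m → F m = 0) :
    ∑ᶠ g : FreeGroup (Fin k), F (FreeGroup.norm g) =
      ∑ m ∈ Finset.range (n + 1), vol k m * F m := by
  classical
  rw [finsum_eq_sum_of_support_subset (s := (Finset.range (n + 1)).biUnion (sph k)),
    Finset.sum_biUnion]
  · refine Finset.sum_congr rfl fun m _ => ?_
    rw [vol_eq, ← nsmul_eq_mul, ← Finset.sum_const]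
    exact Finset.sum_congr rfl fun g hg => by rw [mem_sph.1 hg]
  · intro a _ b _ hab
    refine Finset.disjoint_left.2 fun g h1 h2 => hab ?_
    rw [← mem_sph.1 h1, mem_sph.1 h2]
  · intro g hg
    simp only [Finset.coe_biUnion, Set.mem_iUnion, Finset.mem_coe, mem_sph, Finset.mem_range]
    refine ⟨FreeGroup.norm g, ?_, rfl⟩
    by_contra h
    exact hg (hF _ (by omega))

/-- law of the norm -/
noncomputable def law (k n m : ℕ) : ℝ := vol k m * prof k n m

end FGE
namespace FGE

lemma vol_pos {k : ℕ} (hk : 2 ≤ k) (m : ℕ) : 0 < vol k m := by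
  have h2 : (2 : ℝ) ≤ k := by exact_mod_cast hk
  have : 0 < 2 * (k : ℝ) - 1 := by linarith
  cases m with
  | zero => rw [vol_zero]; norm_num
  | succ m => rw [vol_formula]; positivity

lemma law_nonneg {k : ℕ} (hk : 2 ≤ k) (n m : ℕ) : 0 ≤ law k n m :=
  mul_nonneg (vol_pos hk m).le (prof_nonneg hk n m)

lemma law_step {k : ℕ} (hk : 2 ≤ k) (n : ℕ) (F : ℕ → ℝ) :
    ∑ m ∈ Finset.range (n + 2), law k (n + 1) m * F m =
    ∑ m ∈ Finset.range (n + 1), law k n m * (if m = 0 then F 1 else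
      (F (m - 1) + (2 * (k : ℝ) - 1) * F (m + 1)) / (2 * (k : ℝ))) := by
  have hk0 : (k : ℝ) ≠ 0 := by positivity
  have L : ∑ m ∈ Finset.range (n + 2), law k (n + 1) m * F m =
      ∑ j ∈ Finset.range (n + 1), vol k (j + 1) / (2 * k) * prof k n j * F (j + 1) +
      ∑ j ∈ Finset.range (n + 2), vol k (j + 1) / (2 * k) * prof k n (j + 1) * F j := by
    rw [Finset.sum_range_succ', Finset.sum_range_succ' _ (n + 1), ← add_assoc,
      ← Finset.sum_add_distrib]
    congr 1
    · refine Finset.sum_congr rfl fun j _ => ?_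
      rw [vol_succ k (j + 1)]
      simp only [law, prof, Nat.add_eq_zero_iff, one_ne_zero, and_false, if_false,
        Nat.add_sub_cancel]
      ring
    · rw [vol_formula]
      simp only [law, prof, vol_zero, pow_zero, if_true, zero_add]
      field_simp
  have R : ∑ m ∈ Finset.range (n + 1), law k n m * (if m = 0 then F 1 else
      (F (m - 1) + (2 * (k : ℝ) - 1) * F (m + 1)) / (2 * (k : ℝ))) =
      ∑ j ∈ Finset.range (n + 1), vol k (j + 1) / (2 * k) * prof k n j * F (j + 1) +
      ∑ j ∈ Finset.range n, vol k (j + 1) / (2 * k) * prof k n (j + 1) * F j := by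
    rw [Finset.sum_range_succ', Finset.sum_range_succ' _ n, add_right_comm,
      ← Finset.sum_add_distrib]
    congr 1
    · refine Finset.sum_congr rfl fun j _ => ?_
      rw [vol_succ k (j + 1)]
      simp only [law, Nat.add_eq_zero_iff, one_ne_zero, and_false, if_false,
        Nat.add_sub_cancel]
      ring
    · rw [vol_formula]
      simp only [law, vol_zero, pow_zero, if_true, zero_add]
      field_simp
  have T : ∑ j ∈ Finset.range (n + 2), vol k (j + 1) / (2 * k) * prof k n (j + 1) * F j =
      ∑ j ∈ Finset.range n, vol k (j + 1) / (2 * k) * prof k n (j + 1) * F j := by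
    rw [Finset.sum_range_succ _ (n + 1), Finset.sum_range_succ _ n,
      prof_zero n (n + 1) (by omega), prof_zero n (n + 1 + 1) (by omega)]
    simp
  rw [L, R, T]

lemma law_mass {k : ℕ} (hk : 2 ≤ k) (n : ℕ) : ∑ m ∈ Finset.range (n + 1), law k n m = 1 := by
  have hk0 : (k : ℝ) ≠ 0 := by positivity
  induction n with
  | zero => simp [law, prof, vol_zero]
  | succ n ih =>
    have := law_step hk n (fun _ => 1)
    simp only [mul_one] at this
    refine (this.trans (Finset.sum_congr rfl fun m _ => ?_)).trans ih
    split_ifs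
    · exact mul_one _
    · field_simp; ring

noncomputable def drift (k n : ℕ) : ℝ := ∑ m ∈ Finset.range (n + 1), law k n m * (m : ℝ)

lemma drift_succ {k : ℕ} (hk : 2 ≤ k) (n : ℕ) :
    drift k (n + 1) = drift k n + ((k : ℝ) - 1) / k + prof k n 0 / k := by
  have hk0 : (k : ℝ) ≠ 0 := by positivity
  have h := law_step hk n (fun m => (m : ℝ))
  have e : ∀ m ∈ Finset.range (n + 1), law k n m * (if m = 0 then ((1 : ℕ) : ℝ) else
      (((m - 1 : ℕ) : ℝ) + (2 * (k : ℝ) - 1) * ((m + 1 : ℕ) : ℝ)) / (2 * (k : ℝ))) =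
      law k n m * m + law k n m * (((k : ℝ) - 1) / k) +
        (if m = 0 then prof k n 0 / k else 0) := by
    intro m _
    split_ifs with h0
    · subst h0
      simp only [law, vol_zero]
      push_cast
      field_simp
      ring
    · obtain ⟨j, rfl⟩ : ∃ j, m = j + 1 := ⟨m - 1, by omega⟩
      simp only [Nat.add_sub_cancel]
      push_cast
      field_simp
      ring
  rw [Finset.sum_congr rfl e, Finset.sum_add_distrib, Finset.sum_add_distrib, ← Finset.sum_mul,
    law_mass hk] at h
  rw [drift, h, drift]
  simp

lemma drift_bound {k : ℕ} (hk : 2 ≤ k) (n : ℕ) :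
    n * (((k : ℝ) - 1) / k) ≤ drift k n ∧
      drift k n ≤ n * (((k : ℝ) - 1) / k) + 8 * (1 - (7 / 8) ^ n) := by
  have h2 : (2 : ℝ) ≤ k := by exact_mod_cast hk
  induction n with
  | zero => simp [drift]
  | succ n ih =>
    rw [drift_succ hk]
    have h0 := prof_nonneg hk n 0
    have h1 := prof_le hk n 0
    have h3 : prof k n 0 / k ≤ prof k n 0 := div_le_self h0 (by linarith)
    have h4 : 0 ≤ prof k n 0 / k := by positivity
    push_cast
    constructor
    · linarith [ih.1]
    · rw [pow_succ]; simp only [pow_zero, mul_one] at h1; linarith [ih.2]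

lemma tendsto_of_bdd (u : ℕ → ℝ) (a C : ℝ) (l : ℝ)
    (h : ∀ n : ℕ, |u n - n * a| ≤ C + Real.log (n + 1))
    (hl : Tendsto (fun n : ℕ => u n / (n : ℝ)) atTop (nhds l)) : l = a := by
  refine tendsto_nhds_unique hl ?_
  have hlog : Tendsto (fun n : ℕ => (C + Real.log ((n : ℝ) + 1)) / (n : ℝ)) atTop (nhds 0) := by
    have h1 : Tendsto (fun x : ℝ => Real.log x / x) atTop (nhds 0) :=
      Real.isLittleO_log_id_atTop.tendsto_div_nhds_zero
    have h2 : Tendsto (fun n : ℕ => ((n : ℝ) + 1)) atTop atTop :=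
      tendsto_atTop_add_const_right _ _ tendsto_natCast_atTop_atTop
    have h3 := h1.comp h2
    have h4 : Tendsto (fun n : ℕ => 1 / (n : ℝ)) atTop (nhds 0) :=
      tendsto_one_div_atTop_nhds_zero_nat
    have h5 := (h4.const_mul C).add (h3.mul (h4.const_add 1))
    simp only [mul_zero, add_zero, mul_one] at h5
    refine h5.congr' ?_
    filter_upwards [eventually_gt_atTop 0] with n hn
    have : (n : ℝ) ≠ 0 := by positivity
    have : (n : ℝ) + 1 ≠ 0 := by positivity
    simp only [Function.comp]
    field_simp
  rw [tendsto_iff_norm_sub_tendsto_zero]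
  refine squeeze_zero' (Eventually.of_forall fun n => norm_nonneg _) ?_ hlog
  filter_upwards [eventually_gt_atTop 0] with n hn
  have hn' : (0 : ℝ) < n := by positivity
  have e : u n / n - a = (u n - n * a) / n := by field_simp
  rw [e, Real.norm_eq_abs, abs_div, abs_of_pos hn']
  exact div_le_div_of_nonneg_right (h n) hn'.le

lemma log_vol {k : ℕ} (hk : 2 ≤ k) (m : ℕ) :
    m * Real.log (2 * (k : ℝ) - 1) ≤ Real.log (vol k m) ∧
    Real.log (vol k m) ≤ m * Real.log (2 * (k : ℝ) - 1) + Real.log 2 := by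
  have h2 : (2 : ℝ) ≤ k := by exact_mod_cast hk
  have hq : 0 < 2 * (k : ℝ) - 1 := by linarith
  cases m with
  | zero => rw [vol_zero]; simp [Real.log_nonneg]
  | succ m =>
    have hp : 0 < (2 * (k : ℝ) - 1) ^ m := by positivity
    rw [← Real.log_pow, ← Real.log_mul (by positivity) (by norm_num), vol_formula, pow_succ]
    constructor
    · exact Real.log_le_log (by positivity) (by nlinarith)
    · exact Real.log_le_log (by positivity) (by nlinarith)

lemma ent_eq {k : ℕ} (hk : 2 ≤ k) (n : ℕ) :
    shannonEntropy (convPow (freeUniform k) n) =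
      ∑ m ∈ Finset.range (n + 1), law k n m * Real.log (vol k m) +
      ∑ m ∈ Finset.range (n + 1), -(law k n m * Real.log (law k n m)) := by
  unfold shannonEntropy
  simp only [convPow_eq hk]
  rw [finsum_radial k n (fun m => prof k n m * Real.log (prof k n m))
    (fun m hm => by simp [prof_zero n m hm]), ← Finset.sum_neg_distrib, ← Finset.sum_add_distrib]
  refine Finset.sum_congr rfl fun m _ => ?_
  by_cases h : prof k n m = 0
  · simp [law, h]
  · rw [law, Real.log_mul (vol_pos hk m).ne' h]; ring

lemma law_ent {k : ℕ} (hk : 2 ≤ k) (n : ℕ) :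
    0 ≤ ∑ m ∈ Finset.range (n + 1), -(law k n m * Real.log (law k n m)) ∧
    ∑ m ∈ Finset.range (n + 1), -(law k n m * Real.log (law k n m)) ≤ Real.log (n + 1) := by
  have hmass := law_mass hk n
  constructor
  · refine Finset.sum_nonneg fun m hm => ?_
    have h1 : law k n m ≤ 1 := by
      rw [← hmass]
      exact Finset.single_le_sum (f := fun m => law k n m) (fun i _ => law_nonneg hk n i) hm
    have := mul_nonneg (law_nonneg hk n m) (neg_nonneg.2 (Real.log_nonpos (law_nonneg hk n m) h1))
    linarith
  · have hN : (0 : ℝ) < (n : ℝ) + 1 := by positivity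
    have key : ∀ m ∈ Finset.range (n + 1), -(law k n m * Real.log (law k n m)) ≤
        law k n m * Real.log (n + 1) + (1 / ((n : ℝ) + 1) - law k n m) := by
      intro m _
      rcases (law_nonneg hk n m).eq_or_lt with h | h
      · rw [← h]; simp; positivity
      · have h1 := Real.log_le_sub_one_of_pos (x := 1 / (law k n m * (n + 1))) (by positivity)
        rw [one_div, Real.log_inv, Real.log_mul h.ne' hN.ne'] at h1
        have h3 := mul_le_mul_of_nonneg_left h1 h.le
        have e : law k n m * ((law k n m * ((n : ℝ) + 1))⁻¹ - 1) = 1 / ((n : ℝ) + 1) - law k n m := by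
          field_simp
        rw [e] at h3
        linarith
    refine (Finset.sum_le_sum key).trans ?_
    rw [Finset.sum_add_distrib, ← Finset.sum_mul, Finset.sum_sub_distrib, hmass]
    simp
    field_simp
    simp

lemma ent_bound {k : ℕ} (hk : 2 ≤ k) (n : ℕ) :
    drift k n * Real.log (2 * (k : ℝ) - 1) ≤ shannonEntropy (convPow (freeUniform k) n) ∧
    shannonEntropy (convPow (freeUniform k) n) ≤
      drift k n * Real.log (2 * (k : ℝ) - 1) + Real.log 2 + Real.log (n + 1) := by
  rw [ent_eq hk]
  have h := law_ent hk n
  have A : drift k n * Real.log (2 * (k : ℝ) - 1) ≤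
      ∑ m ∈ Finset.range (n + 1), law k n m * Real.log (vol k m) := by
    rw [drift, Finset.sum_mul]
    refine Finset.sum_le_sum fun m _ => ?_
    rw [mul_assoc]
    exact mul_le_mul_of_nonneg_left (log_vol hk m).1 (law_nonneg hk n m)
  have B : ∑ m ∈ Finset.range (n + 1), law k n m * Real.log (vol k m) ≤
      drift k n * Real.log (2 * (k : ℝ) - 1) + Real.log 2 := by
    have : Real.log 2 = ∑ m ∈ Finset.range (n + 1), law k n m * Real.log 2 := by
      rw [← Finset.sum_mul, law_mass hk, one_mul]
    rw [this, drift, Finset.sum_mul, ← Finset.sum_add_distrib]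
    refine Finset.sum_le_sum fun m _ => ?_
    rw [mul_assoc, ← mul_add]
    exact mul_le_mul_of_nonneg_left (log_vol hk m).2 (law_nonneg hk n m)
  constructor <;> linarith [h.1, h.2]

end FGE

/-- Extremality of the natural generators of a free group: for `F_k` (`k ≥ 2`) with `μ`
uniform on the natural generators and their inverses, the logarithmic volume is
`v = log(2k−1)`, the drift is `l = (k−1)/k`, the entropy is `h = ((k−1)/k)·log(2k−1)`,
and the fundamental inequality turns into equality: `h = l · v`. -/
theorem freeGroup_extremal (k : ℕ) (hk : 2 ≤ k) (v l h : ℝ)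
    (hv : Tendsto (fun n : ℕ =>
        Real.log (({g : FreeGroup (Fin k) | FreeGroup.norm g = n}).ncard : ℝ) / (n : ℝ))
      atTop (nhds v))
    (hl : Tendsto (fun n : ℕ =>
        (∑ᶠ g : FreeGroup (Fin k), convPow (freeUniform k) n g * (FreeGroup.norm g : ℝ))
          / (n : ℝ)) atTop (nhds l))
    (hh : Tendsto (fun n : ℕ => shannonEntropy (convPow (freeUniform k) n) / (n : ℝ))
      atTop (nhds h)) :
    v = Real.log (2 * (k : ℝ) - 1) ∧ l = ((k : ℝ) - 1) / (k : ℝ) ∧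
      h = (((k : ℝ) - 1) / (k : ℝ)) * Real.log (2 * (k : ℝ) - 1) ∧ h = l * v := by
  have h2 : (2 : ℝ) ≤ k := by exact_mod_cast hk
  have hlogn : ∀ n : ℕ, 0 ≤ Real.log ((n : ℝ) + 1) := fun n =>
    Real.log_nonneg (by have : (0 : ℝ) ≤ n := n.cast_nonneg; linarith)
  have hq : 0 ≤ Real.log (2 * (k : ℝ) - 1) := Real.log_nonneg (by linarith)
  have hv' : v = Real.log (2 * (k : ℝ) - 1) := by
    refine FGE.tendsto_of_bdd _ _ (Real.log 2) v (fun n => ?_) hv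
    have := FGE.log_vol hk n
    have h3 := hlogn n
    have h4 : 0 ≤ Real.log 2 := Real.log_nonneg (by norm_num)
    unfold FGE.vol at this
    rw [abs_le]
    constructor <;> linarith [this.1, this.2]
  have hl' : l = ((k : ℝ) - 1) / (k : ℝ) := by
    refine FGE.tendsto_of_bdd _ _ 8 l (fun n => ?_) hl
    have h3 := hlogn n
    have e : ∑ᶠ g : FreeGroup (Fin k), convPow (freeUniform k) n g * (FreeGroup.norm g : ℝ) =
        FGE.drift k n := by
      simp only [FGE.convPow_eq hk]
      rw [FGE.finsum_radial k n (fun m => FGE.prof k n m * (m : ℝ))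
        (fun m hm => by simp [FGE.prof_zero n m hm]), FGE.drift]
      exact Finset.sum_congr rfl fun m _ => by rw [FGE.law]; ring
    rw [e, abs_le]
    have hb := FGE.drift_bound hk n
    have hp : (0 : ℝ) ≤ (7 / 8) ^ n := by positivity
    constructor <;> linarith [hb.1, hb.2]
  have hh' : h = (((k : ℝ) - 1) / (k : ℝ)) * Real.log (2 * (k : ℝ) - 1) := by
    refine FGE.tendsto_of_bdd _ _ (8 * Real.log (2 * (k : ℝ) - 1) + Real.log 2) h (fun n => ?_) hh
    have h3 := hlogn n
    have h4 : 0 ≤ Real.log 2 := Real.log_nonneg (by norm_num)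
    have hb := FGE.drift_bound hk n
    have he := FGE.ent_bound hk n
    have hp : (0 : ℝ) ≤ (7 / 8) ^ n := by positivity
    have u1 := mul_le_mul_of_nonneg_right hb.1 hq
    have u2 := mul_le_mul_of_nonneg_right
      (show FGE.drift k n ≤ n * (((k : ℝ) - 1) / k) + 8 by linarith [hb.2]) hq
    rw [abs_le]
    constructor <;> linarith [he.1, he.2]
  exact ⟨hv', hl', hh', by rw [hh', hl', hv']⟩
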